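/- For every truthful continuous single-buyer mechanism defined on all types v with ∫₀¹ v(t) dt = 1, the worst-case revenue satisfies inf_v X_v ≤ 1/e. Equivalently, no truthful continuous single-buyer mechanism satisfies X_v > 1/e for every type v with total value 1. -/

import Mathlib

open MeasureTheory intervalIntegral

/-- A type in the continuous single-buyer game with total value `V`: a
Lipschitz-continuous nonnegative value function `v : [0,1] → [0,∞)` with
`∫₀¹ v(t) dt = V`. -/
def IsCType (V : ℝ) (v : ℝ → ℝ) : Prop :=
  (∃ K : NNReal, LipschitzOnWith K v (Set.Icc (0:ℝ) 1)) ∧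
  (∀ t ∈ Set.Icc (0:ℝ) 1, 0 ≤ v t) ∧
  (∫ t in (0:ℝ)..1, v t) = V

/-- A truthful continuous single-buyer mechanism `(r, x)` on the domain of all
types of total value `V`: continuous rates in `[0,1]`, continuous nonnegative
payments, per-time individual rationality, and dynamic incentive compatibility. -/
def CTruthful (V : ℝ) (r x : (ℝ → ℝ) → ℝ → ℝ) : Prop :=
  (∀ v, IsCType V v →
    ContinuousOn (r v) (Set.Icc (0:ℝ) 1) ∧ ContinuousOn (x v) (Set.Icc (0:ℝ) 1) ∧
    (∀ t ∈ Set.Icc (0:ℝ) 1,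
      r v t ∈ Set.Icc (0:ℝ) 1 ∧ 0 ≤ x v t ∧ 0 ≤ r v t * v t - x v t)) ∧
  (∀ v v', IsCType V v → IsCType V v' → ∀ τ ∈ Set.Icc (0:ℝ) 1,
    (∀ t ∈ Set.Icc (0:ℝ) τ, 0 ≤ r v' t * v t - x v' t) →
    (∫ t in (0:ℝ)..1, (r v t * v t - x v t)) ≥
      ∫ t in (0:ℝ)..τ, (r v' t * v t - x v' t))

theorem IsCType.exists_lipschitz_extension {V : ℝ} {v : ℝ → ℝ} (hv : IsCType V v) :
    ∃ (K : NNReal) (g : ℝ → ℝ), LipschitzWith K g ∧ Set.EqOn v g (Set.Icc 0 1) := by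
  obtain ⟨⟨K, hK⟩, -⟩ := hv
  obtain ⟨g, hg⟩ := hK.extend_real
  exact ⟨K, g, hg⟩

theorem IsCType.continuousOn {V : ℝ} {v : ℝ → ℝ} (hv : IsCType V v) :
    ContinuousOn v (Set.Icc 0 1) := by
  obtain ⟨⟨K, hK⟩, -⟩ := hv
  exact hK.continuousOn

theorem ContinuousOn.intervalIntegrable_of_subinterval {f : ℝ → ℝ}
    (hf : ContinuousOn f (Set.Icc 0 1)) {a b : ℝ} (ha : 0 ≤ a) (hab : a ≤ b) (hb : b ≤ 1) :
    IntervalIntegrable f volume a b :=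
  (hf.mono (Set.Icc_subset_Icc ha hb)).intervalIntegrable_of_Icc hab

theorem lipschitzWith_const_mul_of_lipschitzWith {K : NNReal} {f : ℝ → ℝ} (hf : LipschitzWith K f)
    (c : ℝ) : ∃ K' : NNReal, LipschitzWith K' fun s => c * f s := by
  refine ⟨‖c‖₊ * K, LipschitzWith.of_dist_le_mul fun s t => ?_⟩
  have h := hf.dist_le_mul s t
  rw [Real.dist_eq, ← mul_sub, abs_mul, ← Real.dist_eq]
  push_cast
  rw [mul_assoc, Real.norm_eq_abs]
  gcongr

/-- The type that follows `v` up to time `a` and then spends its whole remaining value before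
time `b`, first dominating `v` until an intermediate time `τ`. -/
theorem IsCType.exists_front_loaded {v : ℝ → ℝ} (hv : IsCType 1 v) {a b : ℝ} (ha : 0 ≤ a)
    (hab : a < b) (hb : b ≤ 1) :
    ∃ w τ, IsCType 1 w ∧ τ ∈ Set.Icc a b ∧ (∀ s ∈ Set.Icc 0 τ, v s ≤ w s) ∧
      1 - ∫ t in (0:ℝ)..b, v t ≤ ∫ t in a..τ, (w t - v t) := by
  obtain ⟨K, g, hg, hvg⟩ := hv.exists_lipschitz_extension
  have hg0 : ∀ t ∈ Set.Icc (0:ℝ) 1, 0 ≤ g t := fun t ht => hvg ht ▸ hv.2.1 t ht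
  obtain ⟨M, hM⟩ := (isCompact_Icc (a := (0:ℝ)) (b := 1)).bddAbove_image hg.continuous.continuousOn
  replace hM : ∀ t ∈ Set.Icc (0:ℝ) 1, g t ≤ M := fun t ht => hM ⟨t, ht, rfl⟩
  have hM0 : 0 ≤ M := (hg0 0 (by simp)).trans (hM 0 (by simp))
  set m := (a + b) / 2 with hm
  set χ : ℝ → ℝ := fun s => max 0 (M + M / (b - m) * (m - s))
  set β : ℝ → ℝ := fun s => max 0 ((m - a) / 2 - |s - (a + m) / 2|)
  have ham : a < m := by linarith
  have hmb : m < b := by linarith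
  have hχ_ge : ∀ s ≤ m, M ≤ χ s := fun s hs => by
    have : 0 ≤ M / (b - m) * (m - s) :=
      mul_nonneg (div_nonneg hM0 (by linarith)) (by linarith)
    exact le_max_of_le_right (by linarith)
  have hχ_zero : ∀ s, b ≤ s → χ s = 0 := fun s hs => by
    refine max_eq_left ?_
    have h1 : M / (b - m) * (b - m) = M := div_mul_cancel₀ _ (by linarith)
    have h2 : M / (b - m) * (b - m) ≤ M / (b - m) * (s - m) :=
      mul_le_mul_of_nonneg_left (by linarith) (div_nonneg hM0 (by linarith))
    linarith
  have hχ0 : ∀ s, 0 ≤ χ s := fun s => le_max_left _ _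
  have hβ0 : ∀ s, 0 ≤ β s := fun s => le_max_left _ _
  have hβ_left : ∀ s ≤ a, β s = 0 := fun s hs => by
    refine max_eq_left ?_
    linarith [neg_abs_le (s - (a + m) / 2)]
  have hβ_right : ∀ s, m ≤ s → β s = 0 := fun s hs => by
    refine max_eq_left ?_
    linarith [le_abs_self (s - (a + m) / 2)]
  have hβ_pos : ∀ s ∈ Set.Ioo a m, 0 < β s := fun s hs => by
    refine lt_max_of_lt_right ?_
    have : |s - (a + m) / 2| < (m - a) / 2 :=
      abs_lt.2 ⟨by linarith [hs.1], by linarith [hs.2]⟩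
    linarith
  obtain ⟨Kχ, hχL⟩ : ∃ K : NNReal, LipschitzWith K χ := by
    have h0 : LipschitzWith 1 fun s : ℝ => m - s :=
      LipschitzWith.of_dist_le_mul fun s t => by rw [dist_sub_left, NNReal.coe_one, one_mul]
    obtain ⟨K', hK'⟩ := lipschitzWith_const_mul_of_lipschitzWith h0 (M / (b - m))
    exact ⟨_, ((LipschitzWith.const M).add hK').const_max 0⟩
  obtain ⟨Kβ, hβL⟩ : ∃ K : NNReal, LipschitzWith K β :=
    ⟨_, ((LipschitzWith.const ((m - a) / 2)).sub
      (LipschitzWith.dist_left ((a + m) / 2))).const_max 0⟩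
  set p : ℝ → ℝ := fun s => min (g s) (χ s) with hp
  have hpL : LipschitzWith (max K Kχ) p := hg.min hχL
  have hpi : ∀ c d, IntervalIntegrable p volume c d := hpL.continuous.intervalIntegrable
  have hβi : ∀ c d, IntervalIntegrable β volume c d := hβL.continuous.intervalIntegrable
  have hp0 : ∀ t ∈ Set.Icc (0:ℝ) 1, 0 ≤ p t := fun t ht => le_min (hg0 t ht) (hχ0 t)
  have hpv : ∀ t ∈ Set.Icc (0:ℝ) m, p t = v t := fun t ht => by
    have ht' : t ∈ Set.Icc (0:ℝ) 1 := ⟨ht.1, by linarith [ht.2]⟩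
    rw [hvg ht']
    exact min_eq_left ((hM t ht').trans (hχ_ge t ht.2))
  have hvi : IntervalIntegrable v volume 0 b :=
    hv.continuousOn.intervalIntegrable_of_subinterval le_rfl (by linarith) hb
  have hP : ∫ t in (0:ℝ)..1, p t ≤ ∫ t in (0:ℝ)..b, v t := by
    rw [← integral_add_adjacent_intervals (hpi 0 b) (hpi b 1)]
    have h1 : ∫ t in b..1, p t = 0 := by
      rw [integral_congr (g := fun _ => (0:ℝ)), intervalIntegral.integral_zero]
      intro t ht
      rw [Set.uIcc_of_le hb] at ht
      simp only [hp, hχ_zero t ht.1]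
      exact min_eq_right (hg0 t ⟨by linarith [ht.1], ht.2⟩)
    rw [h1, add_zero]
    refine integral_mono_on (by linarith) (hpi _ _) hvi fun t ht => ?_
    rw [hvg ⟨ht.1, ht.2.trans hb⟩]
    exact min_le_left _ _
  have hv1 : ∫ t in (0:ℝ)..b, v t ≤ 1 := by
    rw [← hv.2.2]
    have hvi' := hv.continuousOn.intervalIntegrable_of_subinterval (by linarith) hb le_rfl
    rw [← integral_add_adjacent_intervals hvi hvi', le_add_iff_nonneg_right]
    exact integral_nonneg hb fun t ht => hv.2.1 t ⟨by linarith [ht.1], ht.2⟩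
  set I := ∫ t in a..m, β t with hI
  have hI0 : 0 < I := intervalIntegral_pos_of_pos_on (hβi _ _) hβ_pos ham
  have hI1 : ∫ t in (0:ℝ)..1, β t = I := by
    rw [← integral_add_adjacent_intervals (hβi 0 a) (hβi a 1),
      ← integral_add_adjacent_intervals (hβi a m) (hβi m 1)]
    have h1 : ∫ t in (0:ℝ)..a, β t = 0 := by
      rw [integral_congr (g := fun _ => (0:ℝ)), intervalIntegral.integral_zero]
      intro t ht
      rw [Set.uIcc_of_le ha] at ht
      exact hβ_left t ht.2
    have h2 : ∫ t in m..1, β t = 0 := by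
      rw [integral_congr (g := fun _ => (0:ℝ)), intervalIntegral.integral_zero]
      intro t ht
      rw [Set.uIcc_of_le (by linarith)] at ht
      exact hβ_right t ht.1
    rw [h1, h2, zero_add, add_zero]
  set A := (1 - ∫ t in (0:ℝ)..1, p t) / I
  have hA0 : 0 ≤ A := div_nonneg (by linarith) hI0.le
  have hAI : A * I = 1 - ∫ t in (0:ℝ)..1, p t := div_mul_cancel₀ _ hI0.ne'
  obtain ⟨KA, hAL⟩ := lipschitzWith_const_mul_of_lipschitzWith hβL A
  refine ⟨fun s => p s + A * β s, m, ⟨⟨_, (hpL.add hAL).lipschitzOnWith⟩, fun t ht => ?_, ?_⟩,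
    ⟨ham.le, hmb.le⟩, fun s hs => ?_, ?_⟩
  · exact add_nonneg (hp0 t ht) (mul_nonneg hA0 (hβ0 t))
  · rw [intervalIntegral.integral_add (hpi _ _) ((hβi _ _).const_mul A),
      intervalIntegral.integral_const_mul, hI1, hAI]
    ring
  · rw [← hpv s hs]
    exact le_add_of_nonneg_right (mul_nonneg hA0 (hβ0 s))
  · have h1 : ∫ t in a..m, (p t + A * β t - v t) = A * I := by
      rw [hI, ← intervalIntegral.integral_const_mul]
      refine integral_congr fun t ht => ?_
      rw [Set.uIcc_of_le ham.le] at ht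
      simp only [hpv t ⟨ha.trans ht.1, ht.2⟩]
      ring
    simp only [h1, hAI]
    linarith

theorem neg_mul_log_le_inv_exp_one {B : ℝ} (hB : 0 < B) : -(B * Real.log B) ≤ 1 / Real.exp 1 := by
  have h := Real.log_le_sub_one_of_pos (show 0 < 1 / (Real.exp 1 * B) by positivity)
  rw [one_div, Real.log_inv, Real.log_mul (Real.exp_pos 1).ne' hB.ne', Real.log_exp] at h
  have h2 : -Real.log B ≤ (Real.exp 1 * B)⁻¹ := by linarith
  calc -(B * Real.log B) = B * -Real.log B := by ring
    _ ≤ B * (Real.exp 1 * B)⁻¹ := by gcongr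
    _ = 1 / Real.exp 1 := by field_simp

/-- A rate function that is bounded by `1` and by `B` over the remaining value extracts at most
`B + B log (1 / B)` of the total value. -/
theorem IsCType.integral_rate_mul_le {v : ℝ → ℝ} (hv : IsCType 1 v) {ρ : ℝ → ℝ}
    (hρc : ContinuousOn ρ (Set.Icc 0 1)) (hρ1 : ∀ t ∈ Set.Icc (0:ℝ) 1, ρ t ≤ 1) {B : ℝ}
    (hB0 : 0 < B) (hB1 : B < 1)
    (hρ : ∀ t ∈ Set.Ico (0:ℝ) 1, ρ t * (1 - ∫ s in (0:ℝ)..t, v s) ≤ B) :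
    ∫ t in (0:ℝ)..1, ρ t * v t ≤ B - B * Real.log B := by
  obtain ⟨K, g, hg, hvg⟩ := hv.exists_lipschitz_extension
  set z : ℝ → ℝ := fun t => ∫ s in (0:ℝ)..t, g s with hz
  have hzv : ∀ t ∈ Set.Icc (0:ℝ) 1, ∫ s in (0:ℝ)..t, v s = z t := fun t ht =>
    integral_congr fun s hs => by
      rw [Set.uIcc_of_le ht.1] at hs
      exact hvg ⟨hs.1, hs.2.trans ht.2⟩
  have hzd : ∀ t, HasDerivAt z (g t) t := fun t =>
    (hg.continuous.integral_hasStrictDerivAt 0 t).hasDerivAt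
  have hzc : Continuous z := continuous_iff_continuousAt.2 fun t => (hzd t).continuousAt
  have hz0 : z 0 = 0 := integral_same
  have hz1 : z 1 = 1 := by rw [← hzv 1 (by simp), hv.2.2]
  obtain ⟨T, hT, hzT⟩ : 1 - B ∈ z '' Set.Icc 0 1 :=
    intermediate_value_Icc zero_le_one hzc.continuousOn (by
      rw [hz0, hz1]
      exact ⟨by linarith, by linarith⟩)
  have hT1 : T < 1 := lt_of_le_of_ne hT.2 fun h => by
    rw [h, hz1] at hzT
    linarith
  have hgi : ∀ c d, IntervalIntegrable g volume c d := hg.continuous.intervalIntegrable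
  have hz_le : ∀ t ∈ Set.Icc (0:ℝ) T, z t ≤ 1 - B := fun t ht => by
    have h1 : z t + ∫ s in t..T, g s = z T := integral_add_adjacent_intervals (hgi _ _) (hgi _ _)
    have h2 : 0 ≤ ∫ s in t..T, g s := integral_nonneg ht.2 fun s hs => by
      have hs' : s ∈ Set.Icc (0:ℝ) 1 := ⟨ht.1.trans hs.1, hs.2.trans hT.2⟩
      exact hvg hs' ▸ hv.2.1 s hs'
    linarith
  have hρv : ContinuousOn (fun t => ρ t * v t) (Set.Icc 0 1) := hρc.mul hv.continuousOn
  have hi1 := hρv.intervalIntegrable_of_subinterval le_rfl hT.1 hT.2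
  have hi2 := hρv.intervalIntegrable_of_subinterval hT.1 hT.2 le_rfl
  have hlog : ∀ t ∈ Set.uIcc 0 T,
      HasDerivAt (fun t => -(B * Real.log (1 - z t))) (B * g t / (1 - z t)) t := fun t ht => by
    rw [Set.uIcc_of_le hT.1] at ht
    have hne : 1 - z t ≠ 0 := by linarith [hz_le t ht]
    refine ((((hzd t).const_sub 1).log hne).const_mul B).neg.congr_deriv ?_
    ring
  have hqi : IntervalIntegrable (fun t => B * g t / (1 - z t)) volume 0 T := by
    refine ContinuousOn.intervalIntegrable ?_
    refine (continuous_const.mul hg.continuous).continuousOn.div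
      (continuous_const.sub hzc).continuousOn fun t ht => ?_
    rw [Set.uIcc_of_le hT.1] at ht
    linarith [hz_le t ht]
  have h1 : ∫ t in (0:ℝ)..T, ρ t * v t ≤ -(B * Real.log B) := by
    calc ∫ t in (0:ℝ)..T, ρ t * v t ≤ ∫ t in (0:ℝ)..T, B * g t / (1 - z t) := by
          refine integral_mono_on hT.1 hi1 hqi fun t ht => ?_
          have ht' : t ∈ Set.Icc (0:ℝ) 1 := ⟨ht.1, ht.2.trans hT.2⟩
          have hpos : 0 < 1 - z t := by linarith [hz_le t ht]
          have hr := hρ t ⟨ht.1, ht.2.trans_lt hT1⟩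
          rw [hzv t ht'] at hr
          rw [le_div_iff₀ hpos, ← hvg ht', mul_right_comm]
          exact mul_le_mul_of_nonneg_right hr (hv.2.1 t ht')
      _ = -(B * Real.log B) := by
          rw [integral_eq_sub_of_hasDerivAt hlog hqi, hzT, hz0]
          simp
  have h2 : ∫ t in T..1, ρ t * v t ≤ B := by
    calc ∫ t in T..1, ρ t * v t ≤ ∫ t in T..1, g t := by
          refine integral_mono_on hT.2 hi2 (hgi _ _) fun t ht => ?_
          have ht' : t ∈ Set.Icc (0:ℝ) 1 := ⟨hT.1.trans ht.1, ht.2⟩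
          rw [← hvg ht']
          exact mul_le_of_le_one_left (hv.2.1 t ht') (hρ1 t ht')
      _ = z 1 - z T := eq_sub_of_add_eq' (integral_add_adjacent_intervals (hgi _ _) (hgi _ _))
      _ = B := by rw [hz1, hzT]; ring
  rw [← integral_add_adjacent_intervals hi1 hi2]
  linarith

/-- If no type obtains utility above `S`, then the rate of a type times its remaining value is at
most `S`, since the type could be imitated by one that spends its remaining value at once. -/
theorem CTruthful.rate_mul_remaining_le {r x : (ℝ → ℝ) → ℝ → ℝ} (h : CTruthful 1 r x) {S : ℝ}
    (hS : ∀ w, IsCType 1 w → ∫ t in (0:ℝ)..1, (r w t * w t - x w t) ≤ S) {v : ℝ → ℝ}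
    (hv : IsCType 1 v) {a : ℝ} (ha : a ∈ Set.Ico (0:ℝ) 1) :
    r v a * (1 - ∫ s in (0:ℝ)..a, v s) ≤ S := by
  obtain ⟨hrc, hxc, hrx⟩ := h.1 v hv
  have ha' : a ∈ Set.Icc (0:ℝ) 1 := ⟨ha.1, ha.2.le⟩
  have hvi : ∀ c ∈ Set.Icc (0:ℝ) 1, ∀ d ∈ Set.Icc c 1, IntervalIntegrable v volume c d :=
    fun c hc d hd => hv.continuousOn.intervalIntegrable_of_subinterval hc.1 hd.1 hd.2
  obtain ⟨M, hM⟩ := (isCompact_Icc (a := (0:ℝ)) (b := 1)).bddAbove_image hv.continuousOn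
  replace hM : ∀ t ∈ Set.Icc (0:ℝ) 1, v t ≤ M := fun t ht => hM ⟨t, ht, rfl⟩
  have hM0 : 0 ≤ M := (hv.2.1 0 (by simp)).trans (hM 0 (by simp))
  refine le_of_forall_pos_le_add fun ε hε => ?_
  set η := ε / 2 with hη
  have hη0 : 0 < η := by positivity
  obtain ⟨δ, hδ0, hδ⟩ := Metric.continuousOn_iff.1 hrc a ha' η hη0
  set b := min 1 (a + min (δ / 2) (η / (M + 1))) with hb
  have hab : a < b := lt_min ha.2 (lt_add_of_pos_right _ (by positivity))
  have hb1 : b ≤ 1 := min_le_left _ _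
  have hbδ : b - a ≤ δ / 2 := by
    linarith [min_le_right 1 (a + min (δ / 2) (η / (M + 1))), min_le_left (δ / 2) (η / (M + 1))]
  have hbη : M * (b - a) ≤ η := by
    have h1 : b - a ≤ η / (M + 1) := by
      linarith [min_le_right 1 (a + min (δ / 2) (η / (M + 1))),
        min_le_right (δ / 2) (η / (M + 1))]
    rw [le_div_iff₀ (by positivity)] at h1
    linarith
  have hb' : b ∈ Set.Icc a 1 := ⟨hab.le, hb1⟩
  have hzb : ∫ s in (0:ℝ)..b, v s ≤ (∫ s in (0:ℝ)..a, v s) + η := by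
    rw [← integral_add_adjacent_intervals (hvi 0 (by simp) a ha') (hvi a ha' b hb')]
    have h1 : ∫ s in a..b, v s ≤ ∫ _ in a..b, M :=
      integral_mono_on hab.le (hvi a ha' b hb') (intervalIntegrable_const (μ := volume))
        fun s hs => hM s ⟨ha.1.trans hs.1, hs.2.trans hb1⟩
    rw [intervalIntegral.integral_const, smul_eq_mul] at h1
    linarith
  have hzb1 : ∫ s in (0:ℝ)..b, v s ≤ 1 := by
    rw [← hv.2.2, ← integral_add_adjacent_intervals (hvi 0 (by simp) b ⟨ha.1.trans hab.le, hb1⟩)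
      (hvi b ⟨ha.1.trans hab.le, hb1⟩ 1 ⟨hb1, le_rfl⟩), le_add_iff_nonneg_right]
    exact integral_nonneg hb1 fun t ht => hv.2.1 t ⟨ha.1.trans (hab.le.trans ht.1), ht.2⟩
  obtain ⟨w, τ, hw, hτ, hvw, hmass⟩ := hv.exists_front_loaded ha.1 hab hb1
  have hτ1 : τ ≤ 1 := hτ.2.trans hb1
  have hτ0 : 0 ≤ τ := ha.1.trans hτ.1
  have hIR : ∀ t ∈ Set.Icc (0:ℝ) τ, 0 ≤ r v t * w t - x v t := fun t ht => by
    have ht' := hrx t ⟨ht.1, ht.2.trans hτ1⟩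
    have := mul_le_mul_of_nonneg_left (hvw t ht) ht'.1.1
    linarith [ht'.2.2]
  have hdev := (h.2 w v hw hv τ ⟨hτ0, hτ1⟩ hIR).le.trans (hS w hw)
  set ρ := max 0 (r v a - η)
  have hwv : ContinuousOn (fun t => w t - v t) (Set.Icc 0 1) := hw.continuousOn.sub hv.continuousOn
  have hu : ContinuousOn (fun t => r v t * w t - x v t) (Set.Icc 0 1) :=
    (hrc.mul hw.continuousOn).sub hxc
  have hgain : ρ * (1 - ∫ s in (0:ℝ)..b, v s) ≤ ∫ t in (0:ℝ)..τ, (r v t * w t - x v t) := by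
    calc ρ * (1 - ∫ s in (0:ℝ)..b, v s) ≤ ρ * ∫ t in a..τ, (w t - v t) :=
          mul_le_mul_of_nonneg_left hmass (le_max_left _ _)
      _ = ∫ t in a..τ, ρ * (w t - v t) := (intervalIntegral.integral_const_mul _ _).symm
      _ ≤ ∫ t in a..τ, (r v t * w t - x v t) := by
          refine integral_mono_on hτ.1
            ((hwv.intervalIntegrable_of_subinterval ha.1 hτ.1 hτ1).const_mul ρ)
            (hu.intervalIntegrable_of_subinterval ha.1 hτ.1 hτ1) fun t ht => ?_
          have ht0 : 0 ≤ t := ha.1.trans ht.1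
          have ht1 : t ≤ 1 := ht.2.trans hτ1
          obtain ⟨hr, -, hIRv⟩ := hrx t ⟨ht0, ht1⟩
          have hdist : dist (r v t) (r v a) < η := hδ t ⟨ht0, ht1⟩ (by
            rw [Real.dist_eq, abs_of_nonneg (by linarith [ht.1])]
            linarith [ht.2, hτ.2])
          rw [Real.dist_eq] at hdist
          have hρr : ρ ≤ r v t := max_le hr.1 (by linarith [(abs_lt.1 hdist).1])
          have := mul_le_mul_of_nonneg_right hρr (sub_nonneg.2 (hvw t ⟨ht0, ht.2⟩))
          linarith
      _ ≤ ∫ t in (0:ℝ)..τ, (r v t * w t - x v t) := by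
          rw [← integral_add_adjacent_intervals
            (hu.intervalIntegrable_of_subinterval le_rfl ha.1 ha.2.le)
            (hu.intervalIntegrable_of_subinterval ha.1 hτ.1 hτ1), le_add_iff_nonneg_left]
          exact integral_nonneg ha.1 fun t ht => hIR t ⟨ht.1, ht.2.trans hτ.1⟩
  have hr1 : r v a ≤ 1 := (hrx a ha').1.2
  have hr0 : 0 ≤ r v a := (hrx a ha').1.1
  have hρr : r v a - η ≤ ρ := le_max_right _ _
  have hb0 : 0 ≤ ∫ s in (0:ℝ)..b, v s :=
    integral_nonneg (ha.1.trans hab.le) fun s hs => hv.2.1 s ⟨hs.1, hs.2.trans hb1⟩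
  generalize (∫ s in (0:ℝ)..b, v s) = zb at *
  generalize (∫ s in (0:ℝ)..a, v s) = za at *
  have e1 : (r v a - η) * (1 - zb) ≤ ρ * (1 - zb) :=
    mul_le_mul_of_nonneg_right hρr (by linarith)
  have e2 : r v a * (1 - za - η) ≤ r v a * (1 - zb) :=
    mul_le_mul_of_nonneg_left (by linarith) hr0
  have e3 : r v a * η ≤ η := mul_le_of_le_one_left hη0.le hr1
  have e4 : 0 ≤ η * zb := mul_nonneg hη0.le hb0
  linarith

theorem isCType_const_one : IsCType 1 fun _ => 1 :=
  ⟨⟨0, (LipschitzWith.const 1).lipschitzOnWith⟩, fun _ _ => zero_le_one, by simp⟩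

/-- No truthful continuous single-buyer mechanism has worst-case revenue
exceeding `1/e` on types of total value `1`. -/
theorem stmt6 (r x : (ℝ → ℝ) → ℝ → ℝ) (h : CTruthful 1 r x) :
    sInf {X : ℝ | ∃ v, IsCType 1 v ∧ X = ∫ t in (0:ℝ)..1, x v t} ≤ 1 / Real.exp 1 := by
  set R := {X : ℝ | ∃ v, IsCType 1 v ∧ X = ∫ t in (0:ℝ)..1, x v t}
  set 𝒰 := {u : ℝ | ∃ v, IsCType 1 v ∧ u = ∫ t in (0:ℝ)..1, (r v t * v t - x v t)}
  by_contra! hlt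
  have hRbdd : BddBelow R := ⟨0, by
    rintro _ ⟨v, hv, rfl⟩
    exact integral_nonneg zero_le_one fun t ht => ((h.1 v hv).2.2 t ht).2.1⟩
  have hrevenue : ∀ v, IsCType 1 v → sInf R ≤ ∫ t in (0:ℝ)..1, x v t := fun v hv =>
    csInf_le hRbdd ⟨v, hv, rfl⟩
  have hutility : ∀ v, IsCType 1 v → ∫ t in (0:ℝ)..1, (r v t * v t - x v t) =
      (∫ t in (0:ℝ)..1, r v t * v t) - ∫ t in (0:ℝ)..1, x v t := fun v hv =>
    intervalIntegral.integral_sub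
      (((h.1 v hv).1.mul hv.continuousOn).intervalIntegrable_of_Icc zero_le_one)
      ((h.1 v hv).2.1.intervalIntegrable_of_Icc zero_le_one)
  have hwelfare : ∀ v, IsCType 1 v → ∫ t in (0:ℝ)..1, r v t * v t ≤ 1 := fun v hv => by
    refine hv.2.2.le.trans' (integral_mono_on zero_le_one
      (((h.1 v hv).1.mul hv.continuousOn).intervalIntegrable_of_Icc zero_le_one)
      (hv.continuousOn.intervalIntegrable_of_Icc zero_le_one) fun t ht => ?_)
    exact mul_le_of_le_one_left (hv.2.1 t ht) ((h.1 v hv).2.2 t ht).1.2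
  have hUne : 𝒰.Nonempty := ⟨_, _, isCType_const_one, rfl⟩
  have hU_le : ∀ u ∈ 𝒰, u ≤ 1 - sInf R := by
    rintro _ ⟨v, hv, rfl⟩
    linarith [hrevenue v hv, hutility v hv, hwelfare v hv]
  have hUbdd : BddAbove 𝒰 := ⟨_, hU_le⟩
  have hS0 : 0 ≤ sSup 𝒰 := Real.sSup_nonneg (by
    rintro _ ⟨v, hv, rfl⟩
    exact integral_nonneg zero_le_one fun t ht => ((h.1 v hv).2.2 t ht).2.2)
  have hS1 : sSup 𝒰 ≤ 1 - sInf R := csSup_le hUne hU_le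
  have he : 0 < 1 / Real.exp 1 := by positivity
  set ε := (sInf R - 1 / Real.exp 1) / 3 with hε
  have hε0 : 0 < ε := by linarith
  obtain ⟨_, ⟨v, hv, rfl⟩, hvS⟩ := exists_lt_of_lt_csSup hUne (sub_lt_self (sSup 𝒰) hε0)
  have hrate : ∀ a ∈ Set.Ico (0:ℝ) 1,
      r v a * (1 - ∫ s in (0:ℝ)..a, v s) ≤ sSup 𝒰 + ε := fun a ha =>
    (h.rate_mul_remaining_le (fun w hw => le_csSup hUbdd ⟨w, hw, rfl⟩) hv ha).trans (by linarith)
  have hbound := hv.integral_rate_mul_le (h.1 v hv).1 (fun t ht => ((h.1 v hv).2.2 t ht).1.2)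
    (by linarith) (by linarith) hrate
  have hlog := neg_mul_log_le_inv_exp_one (B := sSup 𝒰 + ε) (by linarith)
  linarith [hrevenue v hv, hutility v hv]
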